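/- For u, v ∈ W such that the join u ∨ v exists in the right weak order, the inversion set of the join is N(u ∨ v) = cone(N(u) ∪ N(v)) ∩ Φ. -/

import Mathlib

section RootSystemDefs

variable {S : Type*} {W : Type*} [Group W]

/-- The simple root `α_s` in the vector space `V = S → ℝ`. -/
def simpleRoot [DecidableEq S] (s : S) : S → ℝ := Pi.single s 1

/-- The symmetric bilinear form `B` on `V = S → ℝ` with `B(α_s, α_t) = -cos (π / m s t)`
(with the convention that `B(α_s, α_t) = -1` when `m s t = ∞`, which is encoded by
`Mmat s t = 0`). -/
noncomputable def bform [Fintype S] (Mmat : CoxeterMatrix S) (v u : S → ℝ) : ℝ :=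
  ∑ s : S, ∑ t : S,
    v s * u t * (if Mmat s t = 0 then -1 else -Real.cos (Real.pi / (Mmat s t : ℝ)))

/-- The conic closure of `X`: all nonnegative linear combinations of elements of `X`. -/
def coneOf {V : Type*} [AddCommMonoid V] [Module ℝ V] (X : Set V) : Set V :=
  {v | ∃ (n : ℕ) (c : Fin n → ℝ) (x : Fin n → V),
    (∀ i, 0 ≤ c i) ∧ (∀ i, x i ∈ X) ∧ v = ∑ i, c i • x i}

variable [Fintype S] [DecidableEq S] {Mmat : CoxeterMatrix S}

/-- The root system `Φ = W(Δ)`, for the representation `ρ` of `W` on `V = S → ℝ`. -/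
def rootSet (ρ : W →* ((S → ℝ) ≃ₗ[ℝ] (S → ℝ))) : Set (S → ℝ) :=
  {v | ∃ (w : W) (s : S), v = ρ w (simpleRoot s)}

/-- The positive roots `Φ⁺ = cone(Δ) ∩ Φ`. -/
def posRoots (ρ : W →* ((S → ℝ) ≃ₗ[ℝ] (S → ℝ))) : Set (S → ℝ) :=
  coneOf (Set.range (simpleRoot (S := S))) ∩ rootSet ρ

/-- The negative roots `Φ⁻ = -Φ⁺`. -/
def negRoots (ρ : W →* ((S → ℝ) ≃ₗ[ℝ] (S → ℝ))) : Set (S → ℝ) :=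
  {v | -v ∈ posRoots ρ}

/-- Dominance order: `Dominates ρ a b` means `a ≼ b`, i.e. every `w ∈ W` sending `b` to a
negative root also sends `a` to a negative root. -/
def Dominates (ρ : W →* ((S → ℝ) ≃ₗ[ℝ] (S → ℝ))) (a b : S → ℝ) : Prop :=
  ∀ w : W, ρ w b ∈ negRoots ρ → ρ w a ∈ negRoots ρ

/-- A small root: a positive root dominating no positive root other than itself. -/
def IsSmallRoot (ρ : W →* ((S → ℝ) ≃ₗ[ℝ] (S → ℝ))) (b : S → ℝ) : Prop :=
  b ∈ posRoots ρ ∧ ∀ a ∈ posRoots ρ, Dominates ρ a b → a = b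

/-- `t : W` is the reflection `s_b` in the root `b`: it acts on `V` by
`v ↦ v - 2 B(b, v) b`. -/
def IsReflIn (Mmat : CoxeterMatrix S) (ρ : W →* ((S → ℝ) ≃ₗ[ℝ] (S → ℝ)))
    (t : W) (b : S → ℝ) : Prop :=
  ∀ v : S → ℝ, ρ t v = v - (2 * bform Mmat b v) • b

/-- The (left) inversion set `N(w) = Φ⁺ ∩ w(Φ⁻)`. -/
def invSet (ρ : W →* ((S → ℝ) ≃ₗ[ℝ] (S → ℝ))) (w : W) : Set (S → ℝ) :=
  {b | b ∈ posRoots ρ ∧ ρ w⁻¹ b ∈ negRoots ρ}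

/-- `N¹(w) = {α ∈ Φ⁺ : ℓ(s_α w) = ℓ(w) - 1}`. -/
def nOne (cs : CoxeterSystem Mmat W) (ρ : W →* ((S → ℝ) ≃ₗ[ℝ] (S → ℝ)))
    (w : W) : Set (S → ℝ) :=
  {b | b ∈ posRoots ρ ∧
    ∃ t : W, IsReflIn Mmat ρ t b ∧ cs.length (t * w) + 1 = cs.length w}

/-- A low element of `W`: an element `w` with `N¹(w) ⊆ Σ`. -/
def IsLow (cs : CoxeterSystem Mmat W) (ρ : W →* ((S → ℝ) ≃ₗ[ℝ] (S → ℝ)))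
    (w : W) : Prop :=
  ∀ b ∈ nOne cs ρ w, IsSmallRoot ρ b

end RootSystemDefs

section CoxeterDefs

variable {S : Type*} {W : Type*} [Group W]

/-- The right weak order on `W`: `u ≤ w` iff `w = u * v` with `ℓ(w) = ℓ(u) + ℓ(v)`. -/
def WeakLE {Mmat : CoxeterMatrix S} (cs : CoxeterSystem Mmat W) (u w : W) : Prop :=
  ∃ v : W, w = u * v ∧ cs.length w = cs.length u + cs.length v

/-- `u` is a suffix of `w`: `w = v * u` with `ℓ(w) = ℓ(v) + ℓ(u)`. -/
def IsSuffixOf {Mmat : CoxeterMatrix S} (cs : CoxeterSystem Mmat W) (u w : W) : Prop :=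
  ∃ v : W, w = v * u ∧ cs.length w = cs.length v + cs.length u

/-- `j` is the join (least upper bound) of `u` and `v` in the right weak order. -/
def IsJoin {Mmat : CoxeterMatrix S} (cs : CoxeterSystem Mmat W) (u v j : W) : Prop :=
  WeakLE cs u j ∧ WeakLE cs v j ∧ ∀ k : W, WeakLE cs u k → WeakLE cs v k → WeakLE cs j k

end CoxeterDefs

section Cone

variable {V : Type*} [AddCommMonoid V] [Module ℝ V]

theorem coneOf_eq_span (X : Set V) :
    coneOf X = (Submodule.span {c : ℝ // 0 ≤ c} X : Set V) := by
  ext v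
  rw [SetLike.mem_coe, Submodule.mem_span_set']
  constructor
  · rintro ⟨n, c, x, hc, hx, rfl⟩
    exact ⟨n, fun i => ⟨c i, hc i⟩, fun i => ⟨x i, hx i⟩, rfl⟩
  · rintro ⟨n, c, x, rfl⟩
    exact ⟨n, fun i => c i, fun i => x i, fun i => (c i).2, fun i => (x i).2, rfl⟩

theorem subset_coneOf (X : Set V) : X ⊆ coneOf X := by
  rw [coneOf_eq_span]
  exact Submodule.subset_span

theorem smul_mem_coneOf {X : Set V} {c : ℝ} (hc : 0 ≤ c) {v : V} (hv : v ∈ coneOf X) :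
    c • v ∈ coneOf X := by
  rw [coneOf_eq_span] at *
  exact Submodule.smul_mem _ (⟨c, hc⟩ : {c : ℝ // 0 ≤ c}) hv

theorem add_mem_coneOf {X : Set V} {v w : V} (hv : v ∈ coneOf X) (hw : w ∈ coneOf X) :
    v + w ∈ coneOf X := by
  rw [coneOf_eq_span] at *
  exact Submodule.add_mem _ hv hw

theorem coneOf_induction {X : Set V} {P : V → Prop} (mem : ∀ x ∈ X, P x) (zero : P 0)
    (hadd : ∀ x y, P x → P y → P (x + y)) (smul : ∀ (c : ℝ) (x : V), 0 ≤ c → P x → P (c • x))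
    {v : V} (hv : v ∈ coneOf X) : P v := by
  rw [coneOf_eq_span] at hv
  induction hv using Submodule.span_induction with
  | mem x h => exact mem x h
  | zero => exact zero
  | add x y _ _ hx hy => exact hadd x y hx hy
  | smul c x _ hx => exact smul c x c.2 hx

theorem zero_mem_coneOf (X : Set V) : (0 : V) ∈ coneOf X := by
  rw [coneOf_eq_span]
  exact Submodule.zero_mem _

theorem coneOf_subset_coneOf {X Y : Set V} (h : X ⊆ coneOf Y) : coneOf X ⊆ coneOf Y :=
  fun _ hv => coneOf_induction (P := (· ∈ coneOf Y)) h (zero_mem_coneOf Y)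
    (fun _ _ => add_mem_coneOf) (fun _ _ hc hx => smul_mem_coneOf hc hx) hv

end Cone

section Alternating

open CoxeterSystem

variable {S : Type*} {W : Type*} [Group W] {Mmat : CoxeterMatrix S} (cs : CoxeterSystem Mmat W)

/-- Splitting off a maximal alternating suffix in two letters, one of which is a right descent,
leaves an element that has neither letter as a right descent. -/
theorem exists_eq_mul_alternatingWord {w : W} (s t : S) (ht : cs.IsRightDescent w t) :
    ∃ (y : W) (n : ℕ), 1 ≤ n ∧ w = y * cs.wordProd (alternatingWord s t n) ∧
      cs.length w = cs.length y + n ∧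
      ¬ cs.IsRightDescent y s ∧ ¬ cs.IsRightDescent y t := by
  classical
  let P : ℕ → Prop := fun n => ∃ y : W, w = y * cs.wordProd (alternatingWord s t n) ∧
    cs.length w = cs.length y + n
  have hP1 : P 1 := by
    refine ⟨w * cs.simple t, ?_, ?_⟩
    · simp [alternatingWord]
    · exact ((cs.isRightDescent_iff).1 ht).symm
  have hbound : ∀ n, P n → n ≤ cs.length w := by
    rintro n ⟨y, -, h⟩
    omega
  set n := Nat.findGreatest P (cs.length w) with hn
  have hPn : P n := Nat.findGreatest_spec (hbound 1 hP1) hP1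
  have hn1 : 1 ≤ n := Nat.le_findGreatest (hbound 1 hP1) hP1
  have hmax : ¬ P (n + 1) := fun h => by
    have := Nat.le_findGreatest (hbound _ h) h
    omega
  obtain ⟨y, hy, hl⟩ := hPn
  have hnext : ¬ cs.IsRightDescent y (if Even n then t else s) := fun h => by
    refine hmax ⟨y * cs.simple (if Even n then t else s), ?_, ?_⟩
    · rw [alternatingWord_succ', cs.wordProd_cons, mul_assoc,
        cs.simple_mul_simple_cancel_left, ← hy]
    · have := (cs.isRightDescent_iff).1 h
      omega
  have hfirst : ¬ cs.IsRightDescent y (if Even n then s else t) := fun h => by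
    obtain ⟨k, hk⟩ : ∃ k, n = k + 1 := ⟨n - 1, by omega⟩
    have hlet : (if Even n then s else t) = (if Even k then t else s) := by
      rw [hk]
      by_cases he : Even k <;> simp [he, Nat.even_add_one]
    rw [hlet] at h
    have hw : w = (y * cs.simple (if Even k then t else s)) *
        cs.wordProd (alternatingWord s t k) := by
      rw [hy, hk, alternatingWord_succ', cs.wordProd_cons, mul_assoc]
    have h1 := cs.length_mul_le (y * cs.simple (if Even k then t else s))
      (cs.wordProd (alternatingWord s t k))
    rw [← hw] at h1
    have h2 := cs.length_wordProd_le (alternatingWord s t k)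
    rw [length_alternatingWord] at h2
    have h3 := (cs.isRightDescent_iff).1 h
    omega
  refine ⟨y, n, hn1, hy, hl, ?_⟩
  by_cases he : Even n
  · simp only [he, if_true] at hnext hfirst
    exact ⟨hfirst, hnext⟩
  · simp only [he, if_false] at hnext hfirst
    exact ⟨hnext, hfirst⟩

/-- A reduced factorisation ending in an alternating word with last letter `t`, of an element
without right descent `s`, has fewer than `m s t` alternating letters. -/
theorem lt_of_not_isRightDescent {w y : W} {s t : S} {n : ℕ} (hm : Mmat s t ≠ 0)
    (hw : w = y * cs.wordProd (alternatingWord s t n)) (hl : cs.length w = cs.length y + n)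
    (hs : ¬ cs.IsRightDescent w s) : n < Mmat s t := by
  have hx := cs.length_wordProd_le (alternatingWord s t n)
  have hmul := cs.length_mul_le y (cs.wordProd (alternatingWord s t n))
  rw [← hw] at hmul
  rw [length_alternatingWord] at hx
  rcases lt_trichotomy n (Mmat s t) with h | h | h
  · exact h
  · exfalso
    apply hs
    obtain ⟨k, hk⟩ : ∃ k, n = k + 1 := ⟨n - 1, by omega⟩
    have hbraid := cs.wordProd_braidWord_eq s t
    rw [CoxeterSystem.braidWord, CoxeterSystem.braidWord, Mmat.symmetric t s, ← h, hk] at hbraid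
    have hws : w * cs.simple s = y * cs.wordProd (alternatingWord s t k) := by
      rw [hw, hk, hbraid, alternatingWord_succ, cs.wordProd_concat, mul_assoc,
        cs.simple_mul_simple_cancel_right]
    have h1 := cs.length_mul_le y (cs.wordProd (alternatingWord s t k))
    have h2 := cs.length_wordProd_le (alternatingWord s t k)
    rw [length_alternatingWord] at h2
    rw [CoxeterSystem.IsRightDescent, hws]
    omega
  · refine absurd ?_ (cs.not_isReduced_alternatingWord s t hm h)
    rw [CoxeterSystem.IsReduced, length_alternatingWord]
    omega

end Alternating

section WeakOrder

variable {S : Type*} {W : Type*} [Group W] {Mmat : CoxeterMatrix S} {cs : CoxeterSystem Mmat W}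

theorem weakLE_refl (w : W) : WeakLE cs w w := ⟨1, by simp⟩

theorem WeakLE.trans {a b c : W} (hab : WeakLE cs a b) (hbc : WeakLE cs b c) : WeakLE cs a c := by
  obtain ⟨x, rfl, hx⟩ := hab
  obtain ⟨y, rfl, hy⟩ := hbc
  refine ⟨x * y, mul_assoc _ _ _, ?_⟩
  have h1 := cs.length_mul_le x y
  have h2 := cs.length_mul_le a (x * y)
  rw [← mul_assoc] at h2
  omega

theorem WeakLE.antisymm {a b : W} (hab : WeakLE cs a b) (hba : WeakLE cs b a) : a = b := by
  obtain ⟨x, rfl, hx⟩ := hab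
  obtain ⟨y, -, hy⟩ := hba
  have : x = 1 := (cs.length_eq_zero_iff).1 (by omega)
  simp [this]

theorem WeakLE.isLeftDescent {a b : W} (hab : WeakLE cs a b) {s : S}
    (hs : cs.IsLeftDescent a s) : cs.IsLeftDescent b s := by
  obtain ⟨x, rfl, hx⟩ := hab
  have h1 := cs.length_mul_le (cs.simple s * a) x
  rw [mul_assoc] at h1
  rw [CoxeterSystem.IsLeftDescent] at *
  omega

theorem WeakLE.simple_mul_of_isLeftDescent {a b : W} (hab : WeakLE cs a b) {s : S}
    (hs : cs.IsLeftDescent a s) : WeakLE cs (cs.simple s * a) (cs.simple s * b) := by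
  have hb := (cs.isLeftDescent_iff).1 (hab.isLeftDescent hs)
  have ha := (cs.isLeftDescent_iff).1 hs
  obtain ⟨x, rfl, hx⟩ := hab
  exact ⟨x, (mul_assoc _ _ _).symm, by omega⟩

theorem WeakLE.simple_mul_of_not_isLeftDescent {a b : W} (hab : WeakLE cs a b) {s : S}
    (hs : ¬ cs.IsLeftDescent b s) : WeakLE cs (cs.simple s * a) (cs.simple s * b) := by
  have ha := (cs.not_isLeftDescent_iff).1 (fun h => hs (hab.isLeftDescent h))
  have hb := (cs.not_isLeftDescent_iff).1 hs
  obtain ⟨x, rfl, hx⟩ := hab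
  exact ⟨x, (mul_assoc _ _ _).symm, by omega⟩

end WeakOrder

section Roots

variable {S : Type*} {W : Type*} [Group W] {ρ : W →* ((S → ℝ) ≃ₗ[ℝ] (S → ℝ))}

theorem rho_mul_apply (w x : W) (v : S → ℝ) : ρ (w * x) v = ρ w (ρ x v) := by
  rw [map_mul, LinearEquiv.mul_apply]

theorem rho_simple_rho_simple {Mmat : CoxeterMatrix S} (cs : CoxeterSystem Mmat W) (s : S)
    (v : S → ℝ) :
    ρ (cs.simple s) (ρ (cs.simple s) v) = v := by
  rw [← rho_mul_apply]
  simp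

variable [DecidableEq S]

theorem simpleRoot_nonneg (s : S) : 0 ≤ simpleRoot s := Pi.single_nonneg.2 zero_le_one

theorem eq_smul_simpleRoot {v : S → ℝ} {s : S} (h : ∀ i, i ≠ s → v i = 0) :
    v = v s • simpleRoot s := by
  ext i
  by_cases hi : i = s
  · subst hi
    simp [simpleRoot]
  · simp [simpleRoot, h i hi, hi]

theorem eq_smul_simpleRoot_add {v : S → ℝ} {s t : S} (hst : s ≠ t)
    (h : ∀ i, i ≠ s → i ≠ t → v i = 0) :
    v = v s • simpleRoot s + v t • simpleRoot t := by
  ext i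
  by_cases hs : i = s
  · subst hs
    simp [simpleRoot, hst]
  · by_cases ht : i = t
    · subst ht
      simp [simpleRoot, hs]
    · simp [simpleRoot, h i hs ht, hs, ht]

theorem rho_mem_rootSet (w : W) {b : S → ℝ} (hb : b ∈ rootSet ρ) : ρ w b ∈ rootSet ρ := by
  obtain ⟨x, s, rfl⟩ := hb
  exact ⟨w * x, s, (rho_mul_apply _ _ _).symm⟩

theorem simpleRoot_mem_rootSet (s : S) : simpleRoot s ∈ rootSet ρ := ⟨1, s, by simp⟩

theorem ne_zero_of_mem_rootSet {b : S → ℝ} (hb : b ∈ rootSet ρ) : b ≠ 0 := by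
  obtain ⟨w, s, rfl⟩ := hb
  simp [simpleRoot]

end Roots

section Geometric

open CoxeterSystem

variable {S : Type*} [Fintype S] [DecidableEq S] {W : Type*} [Group W] {Mmat : CoxeterMatrix S}
  {cs : CoxeterSystem Mmat W} {ρ : W →* ((S → ℝ) ≃ₗ[ℝ] (S → ℝ))}

theorem mem_coneOf_simpleRoot_iff {v : S → ℝ} :
    v ∈ coneOf (Set.range (simpleRoot (S := S))) ↔ 0 ≤ v := by
  constructor
  · refine coneOf_induction (P := fun v : S → ℝ => 0 ≤ v) ?_ le_rfl
      (fun _ _ => add_nonneg) (fun _ _ => smul_nonneg)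
    rintro _ ⟨s, rfl⟩
    exact simpleRoot_nonneg s
  · intro hv
    have hsum : v = ∑ s, v s • simpleRoot s := by
      simpa [simpleRoot] using (pi_eq_sum_univ' v)
    rw [hsum, coneOf_eq_span]
    refine Submodule.sum_mem _ fun s _ => ?_
    rw [← SetLike.mem_coe, ← coneOf_eq_span]
    exact smul_mem_coneOf (hv s) (subset_coneOf _ ⟨s, rfl⟩)

theorem bform_simpleRoot (s t : S) : bform Mmat (simpleRoot s) (simpleRoot t) =
    if Mmat s t = 0 then -1 else -Real.cos (Real.pi / (Mmat s t : ℝ)) := by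
  rw [bform, Finset.sum_eq_single s, Finset.sum_eq_single t]
  · simp [simpleRoot]
  · intro i _ hi
    simp [simpleRoot, hi]
  · simp
  · intro i _ hi
    simp [simpleRoot, hi]
  · simp

theorem bform_simpleRoot_self (s : S) : bform Mmat (simpleRoot s) (simpleRoot s) = 1 := by
  simp [bform_simpleRoot]

theorem bform_simpleRoot_comm (s t : S) : bform Mmat (simpleRoot s) (simpleRoot t) =
    bform Mmat (simpleRoot t) (simpleRoot s) := by
  rw [bform_simpleRoot, bform_simpleRoot, Mmat.symmetric s t]

/-- The coefficients of the roots of a dihedral subgroup: a sequence obeying the recursion of the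
Chebyshev polynomials of the second kind. -/
noncomputable def dihedralCoeff (m n : ℕ) : ℝ :=
  if m = 0 then n else Real.sin (n * (Real.pi / m)) / Real.sin (Real.pi / m)

theorem dihedralCoeff_zero (m : ℕ) : dihedralCoeff m 0 = 0 := by
  simp [dihedralCoeff]

theorem sin_pi_div_pos {m : ℕ} (hm : 2 ≤ m) : 0 < Real.sin (Real.pi / m) := by
  have hm' : (2 : ℝ) ≤ m := by exact_mod_cast hm
  apply Real.sin_pos_of_pos_of_lt_pi
  · have := Real.pi_pos
    positivity
  · rw [div_lt_iff₀ (by linarith)]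
    nlinarith [Real.pi_pos]

theorem dihedralCoeff_one {m : ℕ} (hm : m ≠ 1) : dihedralCoeff m 1 = 1 := by
  by_cases h : m = 0
  · simp [dihedralCoeff, h]
  · have := (sin_pi_div_pos (m := m) (by omega)).ne'
    simp [dihedralCoeff, h, this]

theorem dihedralCoeff_nonneg {m n : ℕ} (hm : m ≠ 1) (hn : m ≠ 0 → n ≤ m) :
    0 ≤ dihedralCoeff m n := by
  by_cases h : m = 0
  · simp [dihedralCoeff, h]
  · have h1 := sin_pi_div_pos (m := m) (by omega)
    have hm0 : (0 : ℝ) < m := by exact_mod_cast Nat.pos_of_ne_zero h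
    have hle : (n : ℝ) ≤ m := by exact_mod_cast hn h
    rw [dihedralCoeff, if_neg h]
    refine div_nonneg (Real.sin_nonneg_of_nonneg_of_le_pi ?_ ?_) h1.le
    · have := Real.pi_pos
      positivity
    · calc (n : ℝ) * (Real.pi / m) ≤ m * (Real.pi / m) := by
            have := Real.pi_pos
            gcongr
        _ = Real.pi := by field_simp

theorem dihedralCoeff_add_two {s t : S} (n : ℕ) : dihedralCoeff (Mmat s t) (n + 2) =
    -2 * bform Mmat (simpleRoot s) (simpleRoot t) * dihedralCoeff (Mmat s t) (n + 1) -
      dihedralCoeff (Mmat s t) n := by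
  rw [bform_simpleRoot]
  by_cases h : Mmat s t = 0
  · simp only [dihedralCoeff, h, if_true]
    push_cast
    ring
  · simp only [dihedralCoeff, h, if_false]
    set θ := Real.pi / (Mmat s t : ℝ)
    have h1 : Real.sin (((n + 2 : ℕ) : ℝ) * θ) =
        2 * Real.cos θ * Real.sin (((n + 1 : ℕ) : ℝ) * θ) - Real.sin (n * θ) := by
      have e1 : ((n + 2 : ℕ) : ℝ) * θ = ((n + 1 : ℕ) : ℝ) * θ + θ := by push_cast; ring
      have e2 : (n : ℝ) * θ = ((n + 1 : ℕ) : ℝ) * θ - θ := by push_cast; ring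
      rw [e1, e2, Real.sin_add, Real.sin_sub]
      ring
    rw [h1]
    ring

/-- `ρ` is the standard geometric representation. -/
def IsGeometricRep (cs : CoxeterSystem Mmat W) (ρ : W →* ((S → ℝ) ≃ₗ[ℝ] (S → ℝ))) : Prop :=
  ∀ (s : S) (v : S → ℝ),
    ρ (cs.simple s) v = v - (2 * bform Mmat (simpleRoot s) v) • simpleRoot s

namespace IsGeometricRep

theorem simple_self (hρ : IsGeometricRep cs ρ) (s : S) :
    ρ (cs.simple s) (simpleRoot s) = -simpleRoot s := by
  rw [hρ, bform_simpleRoot_self]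
  module

theorem simple_apply_of_ne (hρ : IsGeometricRep cs ρ) {s i : S} (h : i ≠ s) (v : S → ℝ) :
    ρ (cs.simple s) v i = v i := by
  rw [hρ]
  simp [simpleRoot, h]

theorem wordProd_apply_of_ne (hρ : IsGeometricRep cs ρ) {s t i : S} (hs : i ≠ s) (ht : i ≠ t)
    (n : ℕ) (v : S → ℝ) : ρ (cs.wordProd (alternatingWord s t n)) v i = v i := by
  induction n with
  | zero => simp [alternatingWord]
  | succ n ih =>
    rw [alternatingWord_succ', cs.wordProd_cons, rho_mul_apply, hρ.simple_apply_of_ne, ih]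
    split_ifs <;> assumption

theorem wordProd_simpleRoot (hρ : IsGeometricRep cs ρ) {s t : S} (hst : s ≠ t) (n : ℕ) :
    ρ (cs.wordProd (alternatingWord s t n)) (simpleRoot s) =
      dihedralCoeff (Mmat s t) (n + 1) • simpleRoot (if Even n then s else t) +
        dihedralCoeff (Mmat s t) n • simpleRoot (if Even n then t else s) := by
  induction n with
  | zero =>
    have hm := Mmat.off_diagonal s t hst
    simp [alternatingWord, dihedralCoeff_zero, dihedralCoeff_one hm]
  | succ n ih =>
    rw [alternatingWord_succ', cs.wordProd_cons, rho_mul_apply, ih, map_add, map_smul, map_smul,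
      hρ.simple_self, hρ _ (simpleRoot _), dihedralCoeff_add_two]
    by_cases he : Even n
    · simp only [he, Nat.even_add_one, not_true, if_true, if_false]
      rw [bform_simpleRoot_comm t s]
      module
    · simp only [he, Nat.even_add_one, not_false_iff, if_true, if_false]
      module

/-- An element lengthened by right multiplication with `s` sends `α_s` to a positive root. -/
theorem nonneg_of_not_isRightDescent (hρ : IsGeometricRep cs ρ) (w : W) (s : S)
    (hs : ¬ cs.IsRightDescent w s) : 0 ≤ ρ w (simpleRoot s) := by
  induction hN : cs.length w using Nat.strong_induction_on generalizing w s with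
  | _ N ih =>
    by_cases h1 : w = 1
    · subst h1
      simpa using simpleRoot_nonneg s
    obtain ⟨t, ht⟩ := cs.exists_rightDescent_of_ne_one h1
    have hst : s ≠ t := fun h => hs (h ▸ ht)
    have hm : Mmat s t ≠ 1 := Mmat.off_diagonal s t hst
    obtain ⟨y, n, hn, hw, hl, hys, hyt⟩ := exists_eq_mul_alternatingWord cs s t ht
    have hlt := fun h => lt_of_not_isRightDescent cs h hw hl hs
    have hys' := ih _ (by omega) y s hys rfl
    have hyt' := ih _ (by omega) y t hyt rfl
    rw [hw, rho_mul_apply, hρ.wordProd_simpleRoot hst, map_add, map_smul, map_smul]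
    have h2 := dihedralCoeff_nonneg hm (n := n + 1) (fun h => hlt h)
    have h3 := dihedralCoeff_nonneg hm (n := n) (fun h => (hlt h).le)
    refine add_nonneg (smul_nonneg h2 ?_) (smul_nonneg h3 ?_) <;> split_ifs <;> assumption

theorem nonpos_of_isRightDescent (hρ : IsGeometricRep cs ρ) {w : W} {s : S}
    (hs : cs.IsRightDescent w s) : ρ w (simpleRoot s) ≤ 0 := by
  have h := hρ.nonneg_of_not_isRightDescent (w * cs.simple s) s
    ((cs.isRightDescent_iff_not_isRightDescent_mul).1 hs)
  rw [rho_mul_apply, hρ.simple_self, map_neg] at h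
  exact neg_nonneg.1 h

theorem nonneg_or_nonpos (hρ : IsGeometricRep cs ρ) {b : S → ℝ} (hb : b ∈ rootSet ρ) :
    0 ≤ b ∨ b ≤ 0 := by
  obtain ⟨w, s, rfl⟩ := hb
  by_cases hs : cs.IsRightDescent w s
  · exact .inr (hρ.nonpos_of_isRightDescent hs)
  · exact .inl (hρ.nonneg_of_not_isRightDescent w s hs)

theorem neg_mem_rootSet (hρ : IsGeometricRep cs ρ) {b : S → ℝ} (hb : b ∈ rootSet ρ) :
    -b ∈ rootSet ρ := by
  obtain ⟨w, s, rfl⟩ := hb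
  exact ⟨w * cs.simple s, s, by rw [rho_mul_apply, hρ.simple_self, map_neg]⟩

theorem mem_invSet_iff (hρ : IsGeometricRep cs ρ) {w : W} {b : S → ℝ} :
    b ∈ invSet ρ w ↔ b ∈ rootSet ρ ∧ 0 ≤ b ∧ ρ w⁻¹ b ≤ 0 := by
  constructor
  · rintro ⟨⟨h1, h2⟩, h3, -⟩
    rw [mem_coneOf_simpleRoot_iff] at h1 h3
    exact ⟨h2, h1, neg_nonneg.1 h3⟩
  · rintro ⟨h1, h2, h3⟩
    exact ⟨⟨mem_coneOf_simpleRoot_iff.2 h2, h1⟩, mem_coneOf_simpleRoot_iff.2 (neg_nonneg.2 h3),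
      hρ.neg_mem_rootSet (rho_mem_rootSet _ h1)⟩

theorem isRightDescent_of_nonpos (hρ : IsGeometricRep cs ρ) {w : W} {s : S}
    (h : ρ w (simpleRoot s) ≤ 0) : cs.IsRightDescent w s := by
  by_contra hs
  exact ne_zero_of_mem_rootSet (rho_mem_rootSet w (simpleRoot_mem_rootSet s))
    (le_antisymm h (hρ.nonneg_of_not_isRightDescent w s hs))

theorem simpleRoot_mem_invSet_iff (hρ : IsGeometricRep cs ρ) {w : W} {s : S} :
    simpleRoot s ∈ invSet ρ w ↔ cs.IsLeftDescent w s := by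
  rw [hρ.mem_invSet_iff, ← cs.isRightDescent_inv_iff]
  exact ⟨fun h => hρ.isRightDescent_of_nonpos h.2.2,
    fun h => ⟨simpleRoot_mem_rootSet s, simpleRoot_nonneg s, hρ.nonpos_of_isRightDescent h⟩⟩

/-- A simple reflection makes only the multiples of its simple root negative. -/
theorem eq_smul_of_simple_nonpos (hρ : IsGeometricRep cs ρ) {s : S} {b : S → ℝ} (hb : 0 ≤ b)
    (hsb : ρ (cs.simple s) b ≤ 0) : b = b s • simpleRoot s := by
  refine eq_smul_simpleRoot fun i hi => le_antisymm ?_ (hb i)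
  have := hsb i
  rwa [hρ.simple_apply_of_ne hi] at this

theorem invSet_subset_invSet_mul_simple (hρ : IsGeometricRep cs ρ) {w : W} {s : S}
    (hs : ¬ cs.IsRightDescent w s) : invSet ρ w ⊆ invSet ρ (w * cs.simple s) := by
  intro b hb
  rw [hρ.mem_invSet_iff] at hb ⊢
  obtain ⟨hroot, hpos, hneg⟩ := hb
  refine ⟨hroot, hpos, ?_⟩
  rw [mul_inv_rev, cs.inv_simple, rho_mul_apply]
  refine (hρ.nonneg_or_nonpos
    (rho_mem_rootSet (cs.simple s) (rho_mem_rootSet w⁻¹ hroot))).resolve_left fun h => ?_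
  have h1 := hρ.eq_smul_of_simple_nonpos (b := -ρ w⁻¹ b) (neg_nonneg.2 hneg)
    (by rw [map_neg]; exact neg_nonpos.2 h)
  have h2 : 0 ≤ ρ w (-ρ w⁻¹ b) := by
    rw [h1, map_smul]
    exact smul_nonneg (neg_nonneg.2 (hneg s)) (hρ.nonneg_of_not_isRightDescent w s hs)
  have h3 : ρ w (ρ w⁻¹ b) = b := by simp
  rw [map_neg, h3] at h2
  exact ne_zero_of_mem_rootSet hroot (le_antisymm (neg_nonneg.1 h2) hpos)

theorem invSet_subset_of_weakLE (hρ : IsGeometricRep cs ρ) {u w : W} (h : WeakLE cs u w) :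
    invSet ρ u ⊆ invSet ρ w := by
  obtain ⟨v, rfl, hl⟩ := h
  induction hN : cs.length v generalizing v with
  | zero =>
    rw [cs.length_eq_zero_iff] at hN
    simp [hN]
  | succ N ih =>
    have hv : v ≠ 1 := fun h => by simp [h] at hN
    obtain ⟨s, hs⟩ := cs.exists_rightDescent_of_ne_one hv
    have h1 := (cs.isRightDescent_iff).1 hs
    have h2 := cs.length_mul_le u (v * cs.simple s)
    have h3 := cs.length_le_length_mul_add_right (u * v) (cs.simple s)
    rw [cs.length_simple, mul_assoc] at h3
    have hd : ¬ cs.IsRightDescent (u * (v * cs.simple s)) s := by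
      rw [CoxeterSystem.IsRightDescent, mul_assoc, cs.simple_mul_simple_cancel_right]
      omega
    have h4 := hρ.invSet_subset_invSet_mul_simple hd
    rw [mul_assoc, cs.simple_mul_simple_cancel_right] at h4
    exact (ih (v * cs.simple s) (by omega) (by omega)).trans h4

theorem coneOf_invSet_inter_subset (hρ : IsGeometricRep cs ρ) (w : W) :
    coneOf (invSet ρ w) ∩ rootSet ρ ⊆ invSet ρ w := by
  rintro b ⟨hb, hroot⟩
  rw [hρ.mem_invSet_iff]
  refine ⟨hroot, coneOf_induction (P := fun b => 0 ≤ b ∧ ρ w⁻¹ b ≤ 0) ?_ ?_ ?_ ?_ hb⟩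
  · exact fun x hx => ((hρ.mem_invSet_iff).1 hx).2
  · simp
  · rintro x y ⟨hx, hx'⟩ ⟨hy, hy'⟩
    rw [map_add]
    exact ⟨add_nonneg hx hy, add_nonpos hx' hy'⟩
  · rintro c x hc ⟨hx, hx'⟩
    rw [map_smul]
    exact ⟨smul_nonneg hc hx, smul_nonpos_of_nonneg_of_nonpos hc hx'⟩

theorem simple_mem_invSet (hρ : IsGeometricRep cs ρ) {w : W} {s : S}
    (hs : cs.IsLeftDescent w s) {b : S → ℝ} (hb : b ∈ invSet ρ (cs.simple s * w)) :
    ρ (cs.simple s) b ∈ invSet ρ w := by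
  obtain ⟨hroot, hpos, hneg⟩ := (hρ.mem_invSet_iff).1 hb
  have hroot' := rho_mem_rootSet (cs.simple s) hroot
  rw [mul_inv_rev, cs.inv_simple, rho_mul_apply] at hneg
  refine (hρ.mem_invSet_iff).2 ⟨hroot', (hρ.nonneg_or_nonpos hroot').resolve_right fun h => ?_,
    hneg⟩
  have h1 := hρ.eq_smul_of_simple_nonpos hpos h
  have h2 := hρ.nonpos_of_isRightDescent ((cs.isRightDescent_inv_iff).2 hs)
  rw [h1, map_smul, hρ.simple_self, map_smul, map_neg, smul_neg] at hneg
  have h3 : ρ w⁻¹ (b s • simpleRoot s) = 0 := by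
    rw [map_smul]
    exact le_antisymm (smul_nonpos_of_nonneg_of_nonpos (hpos s) h2) (neg_nonpos.1 hneg)
  rw [← h1] at h3
  exact ne_zero_of_mem_rootSet (rho_mem_rootSet w⁻¹ hroot) h3

/-- Left multiplication by a common descent `s` of `u` and `v` transports a bound on the inversion
set of an upper bound of `s u` and `s v`. -/
theorem invSet_simple_mul_subset (hρ : IsGeometricRep cs ρ) {u v j : W} {s : S}
    (hu : cs.IsLeftDescent u s) (hv : cs.IsLeftDescent v s)
    (hj : invSet ρ j ⊆ coneOf (invSet ρ (cs.simple s * u) ∪ invSet ρ (cs.simple s * v))) :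
    invSet ρ (cs.simple s * j) ⊆ coneOf (invSet ρ u ∪ invSet ρ v) := by
  intro b hb
  obtain ⟨hroot, hpos, hneg⟩ := (hρ.mem_invSet_iff).1 hb
  rw [mul_inv_rev, cs.inv_simple, rho_mul_apply] at hneg
  have hroot' := rho_mem_rootSet (cs.simple s) hroot
  rcases hρ.nonneg_or_nonpos hroot' with h | h
  · have h1 := hj ((hρ.mem_invSet_iff).2 ⟨hroot', h, hneg⟩)
    rw [← rho_simple_rho_simple (ρ := ρ) cs s b]
    refine coneOf_induction (P := fun x => ρ (cs.simple s) x ∈ coneOf (invSet ρ u ∪ invSet ρ v))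
      ?_ ?_ ?_ ?_ h1
    · rintro x (hx | hx)
      · exact subset_coneOf _ (.inl (hρ.simple_mem_invSet hu hx))
      · exact subset_coneOf _ (.inr (hρ.simple_mem_invSet hv hx))
    · rw [map_zero]
      exact zero_mem_coneOf _
    · intro x y hx hy
      rw [map_add]
      exact add_mem_coneOf hx hy
    · intro c x hc hx
      rw [map_smul]
      exact smul_mem_coneOf hc hx
  · rw [hρ.eq_smul_of_simple_nonpos hpos h]
    exact smul_mem_coneOf (hpos s)
      (subset_coneOf _ (.inl ((hρ.simpleRoot_mem_invSet_iff).2 hu)))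

/-- If `s` and `t` are left descents of `k`, then some element of the dihedral subgroup of `s` and
`t` below `k` has both as left descents. -/
theorem exists_dihedral_weakLE (hρ : IsGeometricRep cs ρ) {k : W} {s t : S} (hst : s ≠ t)
    (hs : cs.IsLeftDescent k s) (ht : cs.IsLeftDescent k t) :
    ∃ x : W, WeakLE cs x k ∧ cs.IsLeftDescent x s ∧ cs.IsLeftDescent x t ∧
      invSet ρ x ⊆ coneOf {simpleRoot s, simpleRoot t} := by
  rw [← cs.isRightDescent_inv_iff] at hs ht
  obtain ⟨y, n, -, hw, hl, hys, hyt⟩ := exists_eq_mul_alternatingWord cs s t ht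
  set x := cs.wordProd (alternatingWord s t n) with hx
  have hys' := hρ.nonneg_of_not_isRightDescent y s hys
  have hyt' := hρ.nonneg_of_not_isRightDescent y t hyt
  have hxl : cs.length x ≤ n := by
    simpa using cs.length_wordProd_le (alternatingWord s t n)
  have hmul := cs.length_mul_le y x
  rw [← hw] at hmul
  have hdesc : ∀ r, r = s ∨ r = t → cs.IsRightDescent k⁻¹ r → cs.IsLeftDescent x⁻¹ r := by
    intro r hr hkr
    rw [cs.isLeftDescent_inv_iff]
    by_contra hxr
    have h1 := hρ.nonneg_of_not_isRightDescent x r hxr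
    have h2 := eq_smul_simpleRoot_add (v := ρ x (simpleRoot r)) hst fun i his hit => by
      have hir : i ≠ r := by rcases hr with rfl | rfl <;> assumption
      rw [hρ.wordProd_apply_of_ne his hit]
      simp [simpleRoot, hir]
    have h3 := hρ.nonpos_of_isRightDescent hkr
    refine ne_zero_of_mem_rootSet (rho_mem_rootSet k⁻¹ (simpleRoot_mem_rootSet r))
      (le_antisymm h3 ?_)
    rw [hw, rho_mul_apply, h2, map_add, map_smul, map_smul]
    exact add_nonneg (smul_nonneg (h1 s) hys') (smul_nonneg (h1 t) hyt')
  refine ⟨x⁻¹, ⟨y⁻¹, ?_, ?_⟩, hdesc s (.inl rfl) hs, hdesc t (.inr rfl) ht, ?_⟩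
  · rw [← mul_inv_rev, ← hw, inv_inv]
  · rw [cs.length_inv] at *
    rw [cs.length_inv]
    omega
  · intro b hb
    obtain ⟨-, hpos, hneg⟩ := (hρ.mem_invSet_iff).1 hb
    rw [inv_inv] at hneg
    rw [eq_smul_simpleRoot_add (v := b) hst fun i his hit => le_antisymm
      (by simpa [hx, hρ.wordProd_apply_of_ne his hit] using hneg i) (hpos i)]
    exact add_mem_coneOf (smul_mem_coneOf (hpos s) (subset_coneOf _ (by simp)))
      (smul_mem_coneOf (hpos t) (subset_coneOf _ (by simp)))

/-- Two elements with an upper bound `k` in the weak order have an upper bound below `k` whose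
inversion set lies in the cone spanned by their inversion sets. -/
theorem exists_upperBound_invSet_subset (hρ : IsGeometricRep cs ρ) {u v k : W}
    (hu : WeakLE cs u k) (hv : WeakLE cs v k) :
    ∃ j : W, WeakLE cs j k ∧ WeakLE cs u j ∧ WeakLE cs v j ∧
      invSet ρ j ⊆ coneOf (invSet ρ u ∪ invSet ρ v) := by
  induction hN : cs.length k using Nat.strong_induction_on generalizing u v k with
  | _ N ih =>
    have common : ∀ {u v : W} (s : S), WeakLE cs u k → WeakLE cs v k → cs.IsLeftDescent u s →
        cs.IsLeftDescent v s → ∃ j : W, WeakLE cs j k ∧ WeakLE cs u j ∧ WeakLE cs v j ∧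
          invSet ρ j ⊆ coneOf (invSet ρ u ∪ invSet ρ v) := by
      intro u v s hu hv hus hvs
      have hks := hu.isLeftDescent hus
      have hlen : cs.length (cs.simple s * k) < N := hN ▸ hks
      obtain ⟨j, hjk, huj, hvj, hN⟩ := ih _ hlen (hu.simple_mul_of_isLeftDescent hus)
        (hv.simple_mul_of_isLeftDescent hvs) rfl
      have hsk := (cs.isLeftDescent_iff_not_isLeftDescent_mul).1 hks
      have hsj : ¬ cs.IsLeftDescent j s := fun h => hsk (hjk.isLeftDescent h)
      refine ⟨cs.simple s * j, ?_, ?_, ?_, hρ.invSet_simple_mul_subset hus hvs hN⟩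
      · simpa using hjk.simple_mul_of_not_isLeftDescent hsk
      · simpa using huj.simple_mul_of_not_isLeftDescent hsj
      · simpa using hvj.simple_mul_of_not_isLeftDescent hsj
    by_cases hu1 : u = 1
    · exact ⟨v, hv, ⟨v, by simp [hu1]⟩, weakLE_refl v,
        Set.subset_union_right.trans (subset_coneOf _)⟩
    by_cases hv1 : v = 1
    · exact ⟨u, hu, weakLE_refl u, ⟨u, by simp [hv1]⟩,
        Set.subset_union_left.trans (subset_coneOf _)⟩
    obtain ⟨s, hs⟩ := cs.exists_leftDescent_of_ne_one hu1
    obtain ⟨t, ht⟩ := cs.exists_leftDescent_of_ne_one hv1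
    by_cases hst : s = t
    · subst hst
      exact common s hu hv hs ht
    obtain ⟨x, hxk, hxs, hxt, hxN⟩ :=
      hρ.exists_dihedral_weakLE hst (hu.isLeftDescent hs) (hv.isLeftDescent ht)
    obtain ⟨v', hv'k, hxv', hvv', hv'N⟩ := common t hxk hv hxt ht
    obtain ⟨j, hjk, huj, hv'j, hjN⟩ := common s hu hv'k hs (hxv'.isLeftDescent hxs)
    refine ⟨j, hjk, huj, hvv'.trans hv'j, hjN.trans (coneOf_subset_coneOf ?_)⟩
    refine Set.union_subset (Set.subset_union_left.trans (subset_coneOf _))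
      (hv'N.trans (coneOf_subset_coneOf (Set.union_subset (hxN.trans (coneOf_subset_coneOf ?_))
        (Set.subset_union_right.trans (subset_coneOf _)))))
    rintro _ (rfl | rfl)
    · exact subset_coneOf _ (.inl ((hρ.simpleRoot_mem_invSet_iff).2 hs))
    · exact subset_coneOf _ (.inr ((hρ.simpleRoot_mem_invSet_iff).2 ht))

end IsGeometricRep

end Geometric

/-- **Lemma 4.1(iii).** For `u, v ∈ W` such that the join `u ∨ v` exists in the right
weak order, `N(u ∨ v) = cone(N(u) ∪ N(v)) ∩ Φ`. -/
theorem invSet_join {S : Type*} [Fintype S] [DecidableEq S]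
    (Mmat : CoxeterMatrix S) {W : Type*} [Group W] (cs : CoxeterSystem Mmat W)
    (ρ : W →* ((S → ℝ) ≃ₗ[ℝ] (S → ℝ)))
    (hfaith : Function.Injective ρ)
    (hρ : ∀ (s : S) (v : S → ℝ),
      ρ (cs.simple s) v = v - (2 * bform Mmat (simpleRoot s) v) • simpleRoot s)
    (u v j : W) (hj : IsJoin cs u v j) :
    invSet ρ j = coneOf (invSet ρ u ∪ invSet ρ v) ∩ rootSet ρ := by
  have hgeom : IsGeometricRep cs ρ := hρ
  obtain ⟨huj, hvj, hmin⟩ := hj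
  apply Set.Subset.antisymm
  · obtain ⟨j', hj'j, huj', hvj', hN⟩ := hgeom.exists_upperBound_invSet_subset huj hvj
    obtain rfl := hj'j.antisymm (hmin j' huj' hvj')
    exact fun b hb => ⟨hN hb, hb.1.2⟩
  · rintro b ⟨hb, hroot⟩
    refine hgeom.coneOf_invSet_inter_subset j ⟨coneOf_subset_coneOf ?_ hb, hroot⟩
    exact (Set.union_subset (hgeom.invSet_subset_of_weakLE huj)
      (hgeom.invSet_subset_of_weakLE hvj)).trans (subset_coneOf _)
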